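/- Let X be a type and let m₁ m₂ : X → X → X be binary operations satisfying the interchange law: for all a b c d : X, m₁ (m₂ a b) (m₂ c d) = m₂ (m₁ a c) (m₁ b d). Then for all k l : ℕ and every matrix a : Fin (k+1) → Fin (l+1) → X, the left-normed products satisfy P_{m₁} (fun i => P_{m₂} (fun j => a i j)) = P_{m₂} (fun j => P_{m₁} (fun i => a i j)), where P_m v denotes the left-normed product v 0 ⋄ v 1 ⋄ ⋯ ⋄ v n (folded from the left with m) of a tuple v : Fin (n+1) → X. No unit, associativity or commutativity hypotheses are needed. -/

import Mathlib

/-- The left-normed product `(((v 0 ⋄ v 1) ⋄ v 2) ⋯ ⋄ v n)` of a tuple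
`v : Fin (n+1) → X` with respect to a binary operation `m`. -/
def leftNormedProd {X : Type*} (m : X → X → X) {n : ℕ} (v : Fin (n + 1) → X) : X :=
  List.foldl m (v 0) (List.ofFn fun i : Fin n => v i.succ)

theorem leftNormedProd_zero {X : Type*} (m : X → X → X) (v : Fin 1 → X) :
    leftNormedProd m v = v 0 := by
  simp [leftNormedProd]

theorem leftNormedProd_succ {X : Type*} (m : X → X → X) {n : ℕ} (v : Fin (n + 2) → X) :
    leftNormedProd m v = m (leftNormedProd m fun i => v i.castSucc) (v (Fin.last (n + 1))) := by
  simp [leftNormedProd, List.ofFn_succ', -List.ofFn_succ]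

/-- The interchange law extends from binary products to left-normed products in `m₂`. -/
theorem interchange_leftNormedProd_binary {X : Type*} {m₁ m₂ : X → X → X}
    (hint : ∀ a b c d : X, m₁ (m₂ a b) (m₂ c d) = m₂ (m₁ a c) (m₁ b d))
    {n : ℕ} (u v : Fin (n + 1) → X) :
    m₁ (leftNormedProd m₂ u) (leftNormedProd m₂ v) =
      leftNormedProd m₂ fun j => m₁ (u j) (v j) := by
  induction n with
  | zero => simp only [leftNormedProd_zero]
  | succ n ih => simp only [leftNormedProd_succ, hint, ih]

/-- All (k,l)-interchanges between iterates of two binary operations follow from the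
single (2,2)-interchange relation. -/
theorem interchange_leftNormedProd {X : Type*} (m₁ m₂ : X → X → X)
    (hint : ∀ a b c d : X, m₁ (m₂ a b) (m₂ c d) = m₂ (m₁ a c) (m₁ b d)) :
    ∀ (k l : ℕ) (a : Fin (k + 1) → Fin (l + 1) → X),
      leftNormedProd m₁ (fun i => leftNormedProd m₂ (fun j => a i j)) =
        leftNormedProd m₂ (fun j => leftNormedProd m₁ (fun i => a i j)) := by
  intro k l a
  induction k with
  | zero => simp only [leftNormedProd_zero]
  | succ k ih =>
    simp only [leftNormedProd_succ m₁, ih fun i => a i.castSucc,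
      interchange_leftNormedProd_binary hint]
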